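/- Let M be a random measure on a Polish space S and let 𝓘 be a countable topological dissecting semi-ring of bounded Borel sets generating the Borel σ-field of S. Then M is positively associated as a random measure if and only if for every n ≥ 1 and all pairwise disjoint sets B_1, …, B_n ∈ 𝓘, the random vector (M(B_1), …, M(B_n)) is positively associated in ℝ₊^n. -/

import Mathlib

open MeasureTheory

/-- The partial order on (Radon) measures on a metric space:
`μ ≤ ν` iff `μ B ≤ ν B` for every bounded Borel set `B`. -/
def MeasLE {S : Type*} [MeasurableSpace S] [MetricSpace S] (μ ν : Measure S) : Prop :=
  ∀ B : Set S, MeasurableSet B → Bornology.IsBounded B → μ B ≤ ν B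

/-- A function on measures is nondecreasing w.r.t. the order `MeasLE`. -/
def MeasMono {S : Type*} [MeasurableSpace S] [MetricSpace S] (F : Measure S → ℝ) : Prop :=
  ∀ μ ν, MeasLE μ ν → F μ ≤ F ν

/-- A function on measures is measurable with respect to a set `A ⊆ S` if it only depends
on the restriction of its argument to `A`. -/
def MeasurableWrt {S : Type*} [MeasurableSpace S] (A : Set S) (F : Measure S → ℝ) : Prop :=
  ∀ μ : Measure S, F μ = F (μ.restrict A)

/-- A random measure `M` is *negatively associated* if
`E[F(M) G(M)] ≤ E[F(M)] E[G(M)]` for every pair `F, G` of bounded nondecreasing measurable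
functions on measures that are measurable with respect to disjoint measurable subsets of `S`. -/
def RMNegAssoc {Ω S : Type*} [MeasurableSpace Ω] [MeasurableSpace S] [MetricSpace S]
    (P : Measure Ω) (M : Ω → Measure S) : Prop :=
  ∀ (A B : Set S), MeasurableSet A → MeasurableSet B → Disjoint A B →
    ∀ F G : Measure S → ℝ,
      Measurable F → MeasMono F → (∃ C, ∀ μ, |F μ| ≤ C) → MeasurableWrt A F →
      Measurable G → MeasMono G → (∃ C, ∀ μ, |G μ| ≤ C) → MeasurableWrt B G →
      ∫ ω, F (M ω) * G (M ω) ∂P ≤ (∫ ω, F (M ω) ∂P) * ∫ ω, G (M ω) ∂P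

/-- A random measure `M` is *positively associated* if
`E[F(M) G(M)] ≥ E[F(M)] E[G(M)]` for every pair `F, G` of bounded nondecreasing
measurable functions on measures. -/
def RMPosAssoc {Ω S : Type*} [MeasurableSpace Ω] [MeasurableSpace S] [MetricSpace S]
    (P : Measure Ω) (M : Ω → Measure S) : Prop :=
  ∀ F G : Measure S → ℝ,
    Measurable F → MeasMono F → (∃ C, ∀ μ, |F μ| ≤ C) →
    Measurable G → MeasMono G → (∃ C, ∀ μ, |G μ| ≤ C) →
    (∫ ω, F (M ω) ∂P) * ∫ ω, G (M ω) ∂P ≤ ∫ ω, F (M ω) * G (M ω) ∂P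

/-- A countable topological dissecting semi-ring of bounded Borel sets generating the
Borel σ-field, as in Kallenberg's theory of random measures: a countable semi-ring of
bounded Borel sets such that every open set is a countable union of its members, every
bounded set is covered by finitely many of its members, and it generates the Borel
σ-field. -/
structure IsDissectingSemiring {S : Type*} [MeasurableSpace S] [MetricSpace S]
    (I : Set (Set S)) : Prop where
  countable : I.Countable
  measurableSet : ∀ B ∈ I, MeasurableSet B
  isBounded : ∀ B ∈ I, Bornology.IsBounded B
  empty_mem : ∅ ∈ I
  inter_mem : ∀ A ∈ I, ∀ B ∈ I, A ∩ B ∈ I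
  diff_eq_disjoint_sUnion : ∀ A ∈ I, ∀ B ∈ I, ∃ F : Finset (Set S),
    ↑F ⊆ I ∧ (F : Set (Set S)).Pairwise Disjoint ∧ A \ B = ⋃₀ ↑F
  isOpen_eq_sUnion : ∀ G : Set S, IsOpen G →
    ∃ C : Set (Set S), C ⊆ I ∧ C.Countable ∧ G = ⋃₀ C
  isBounded_covered : ∀ B : Set S, Bornology.IsBounded B →
    ∃ F : Finset (Set S), ↑F ⊆ I ∧ B ⊆ ⋃₀ ↑F
  generateFrom_eq : MeasurableSpace.generateFrom I = ‹MeasurableSpace S›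

/-- Negative association of finite-dimensional random vectors, with values in `ℝ≥0∞`. -/
def NegAssoc {Ω ι X : Type*} [MeasurableSpace Ω] [MeasurableSpace X] [Preorder X]
    (P : Measure Ω) (Xs : ι → Ω → X) : Prop :=
  ∀ (J : Set ι) (f : (J → X) → ℝ) (g : ((Jᶜ : Set ι) → X) → ℝ),
    Measurable f → Monotone f → (∃ C, ∀ x, |f x| ≤ C) →
    Measurable g → Monotone g → (∃ C, ∀ x, |g x| ≤ C) →
    ∫ ω, f (fun j => Xs j.1 ω) * g (fun j => Xs j.1 ω) ∂P ≤
      (∫ ω, f (fun j => Xs j.1 ω) ∂P) * ∫ ω, g (fun j => Xs j.1 ω) ∂P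

/-- Positive association of finite-dimensional random vectors, with values in `ℝ≥0∞`. -/
def PosAssoc {Ω ι X : Type*} [MeasurableSpace Ω] [MeasurableSpace X] [Preorder X]
    (P : Measure Ω) (Xs : ι → Ω → X) : Prop :=
  ∀ (J : Set ι) (f g : (J → X) → ℝ),
    Measurable f → Monotone f → (∃ C, ∀ x, |f x| ≤ C) →
    Measurable g → Monotone g → (∃ C, ∀ x, |g x| ≤ C) →
    (∫ ω, f (fun j => Xs j.1 ω) ∂P) * ∫ ω, g (fun j => Xs j.1 ω) ∂P ≤
      ∫ ω, f (fun j => Xs j.1 ω) * g (fun j => Xs j.1 ω) ∂P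

open ProbabilityTheory Set Filter Topology
open scoped ENNReal symmDiff

/-- Finitely many members of a semi-ring have a common refinement by finitely many pairwise
disjoint members of the semi-ring. -/
lemma MeasureTheory.IsSetSemiring.exists_disjoint_refinement {α : Type*} {C : Set (Set α)}
    (hC : IsSetSemiring C) (s : Finset (Set α)) (hs : ↑s ⊆ C) :
    ∃ R : Finset (Set α), ↑R ⊆ C ∧ ∅ ∈ R ∧ (∀ x ∈ R, ∀ y ∈ R, ∀ z, z ∈ x → z ∈ y → x = y) ∧
      ∀ A ∈ s, ∀ z ∈ A, ∃ r ∈ R, z ∈ r ∧ r ⊆ A := by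
  classical
  induction s using Finset.induction with
  | empty =>
    exact ⟨{∅}, by simpa using hC.empty_mem, by simp, by simp, by simp⟩
  | insert A s _ ih =>
    rw [Finset.coe_insert, insert_subset_iff] at hs
    obtain ⟨R, hRC, hR0, hRd, hR⟩ := ih hs.2
    have hP : ∀ r : Set α, ∃ Q : Finset (Set α), r ∈ R →
        (↑Q ⊆ C ∧ PairwiseDisjoint (Q : Set (Set α)) id ∧ r \ A = ⋃₀ ↑Q) := fun r ↦ by
      by_cases h : r ∈ R
      · obtain ⟨Q, hQ⟩ := hC.sdiff_eq_sUnion' r (hRC h) A hs.1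
        exact ⟨Q, fun _ ↦ hQ⟩
      · exact ⟨∅, fun h' ↦ absurd h' h⟩
    choose Q hQ using hP
    obtain ⟨D, hDC, hDd, hD⟩ := hC.exists_disjoint_finset_sdiff_eq hs.1 hRC
    have eq_of_mem : ∀ {T : Finset (Set α)}, PairwiseDisjoint (T : Set (Set α)) id →
        ∀ {x y : Set α} {z : α}, x ∈ T → y ∈ T → z ∈ x → z ∈ y → x = y := by
      intro T hT x y z hx hy hzx hzy
      exact hT.elim_set hx hy z hzx hzy
    have hQsub : ∀ r ∈ R, ∀ x ∈ Q r, x ⊆ r \ A := fun r hr x hx ↦ by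
      rw [(hQ r hr).2.2]; exact subset_sUnion_of_mem hx
    have hDsub : ∀ x ∈ D, x ⊆ A \ ⋃₀ ↑R := fun x hx ↦ by
      rw [hD]; exact subset_sUnion_of_mem hx
    refine ⟨R.image (· ∩ A) ∪ R.biUnion Q ∪ D, ?_, ?_, ?_, ?_⟩
    · intro x hx
      simp only [Finset.coe_union, mem_union, Finset.mem_coe, Finset.mem_image,
        Finset.mem_biUnion] at hx
      rcases hx with (⟨r, hr, rfl⟩ | ⟨r, hr, hx⟩) | hx
      · exact hC.inter_mem _ (hRC hr) _ hs.1
      · exact (hQ r hr).1 hx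
      · exact hDC hx
    · simp only [Finset.mem_union, Finset.mem_image]
      exact Or.inl (Or.inl ⟨∅, hR0, by simp⟩)
    · intro x hx y hy z hzx hzy
      simp only [Finset.mem_union, Finset.mem_image, Finset.mem_biUnion] at hx hy
      rcases hx with (⟨r, hr, rfl⟩ | ⟨r, hr, hx⟩) | hx <;>
        rcases hy with (⟨r', hr', rfl⟩ | ⟨r', hr', hy⟩) | hy
      · rw [hRd r hr r' hr' z hzx.1 hzy.1]
      · exact absurd hzx.2 (hQsub r' hr' y hy hzy).2
      · exact absurd (mem_sUnion_of_mem hzx.1 hr) (hDsub y hy hzy).2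
      · exact absurd hzy.2 (hQsub r hr x hx hzx).2
      · obtain rfl := hRd r hr r' hr' z (hQsub r hr x hx hzx).1 (hQsub r' hr' y hy hzy).1
        exact eq_of_mem (hQ r hr).2.1 hx hy hzx hzy
      · exact absurd (mem_sUnion_of_mem (hQsub r hr x hx hzx).1 hr) (hDsub y hy hzy).2
      · exact absurd (mem_sUnion_of_mem hzy.1 hr') (hDsub x hx hzx).2
      · exact absurd (mem_sUnion_of_mem (hQsub r' hr' y hy hzy).1 hr') (hDsub x hx hzx).2
      · exact eq_of_mem hDd hx hy hzx hzy
    · intro B hB z hz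
      simp only [Finset.mem_union, Finset.mem_image, Finset.mem_biUnion]
      rcases Finset.mem_insert.1 hB with rfl | hB
      · by_cases hzR : z ∈ ⋃₀ (R : Set (Set α))
        · obtain ⟨r, hr, hzr⟩ := hzR
          exact ⟨r ∩ B, Or.inl (Or.inl ⟨r, hr, rfl⟩), ⟨hzr, hz⟩, inter_subset_right⟩
        · obtain ⟨d, hd, hzd⟩ := hD.subset ⟨hz, hzR⟩
          exact ⟨d, Or.inr hd, hzd, (hDsub d hd).trans sdiff_subset⟩
      · obtain ⟨r, hr, hzr, hrB⟩ := hR B hB z hz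
        by_cases hzA : z ∈ A
        · exact ⟨r ∩ A, Or.inl (Or.inl ⟨r, hr, rfl⟩), ⟨hzr, hzA⟩, inter_subset_left.trans hrB⟩
        · obtain ⟨d, hd, hzd⟩ := (hQ r hr).2.2.subset ⟨hzr, hzA⟩
          exact ⟨d, Or.inl (Or.inr ⟨r, hr, hd⟩), hzd,
            ((hQsub r hr d hd).trans sdiff_subset).trans hrB⟩

namespace IsDissectingSemiring

variable {S : Type*} [MeasurableSpace S] [MetricSpace S] {I : Set (Set S)}

lemma isSetSemiring (hI : IsDissectingSemiring I) : IsSetSemiring I where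
  empty_mem := hI.empty_mem
  inter_mem := hI.inter_mem
  sdiff_eq_sUnion' A hA B hB := by
    obtain ⟨F, hFI, hF, h⟩ := hI.diff_eq_disjoint_sUnion A hA B hB
    exact ⟨F, hFI, hF, h⟩

lemma sUnion_eq_univ (hI : IsDissectingSemiring I) : ⋃₀ I = univ := by
  obtain ⟨C, hCI, -, hC⟩ := hI.isOpen_eq_sUnion univ isOpen_univ
  exact eq_univ_of_univ_subset (hC ▸ sUnion_subset_sUnion hCI)

lemma measure_ext (hI : IsDissectingSemiring I) {μ ν : Measure S}
    (hμ : ∀ B ∈ I, μ B ≠ ∞) (h : ∀ B ∈ I, μ B = ν B) : μ = ν :=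
  Measure.ext_of_generateFrom_of_cover_subset hI.generateFrom_eq.symm
    hI.isSetSemiring.isPiSystem subset_rfl hI.countable hI.sUnion_eq_univ hμ h

lemma le_of_mem_supClosure (hI : IsDissectingSemiring I) {μ ν : Measure S}
    (h : ∀ B ∈ I, μ B ≤ ν B) {t : Set S} (ht : t ∈ supClosure I) : μ t ≤ ν t := by
  obtain ⟨Q, hQ⟩ := hI.isSetSemiring.mem_supClosure_iff.1 ht
  have key : ∀ m : Measure S, m t = ∑ q ∈ Q.parts, m q := fun m ↦ by
    have ht' : t = ⋃ q ∈ Q.parts, id q := by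
      conv_lhs => rw [← Q.sup_parts, Finset.sup_set_eq_biUnion]
    conv_lhs => rw [ht']
    exact measure_biUnion_finset Q.supIndep.pairwiseDisjoint
      fun q hq ↦ hI.measurableSet q (hQ hq)
  rw [key, key]
  exact Finset.sum_le_sum fun q hq ↦ h q (hQ hq)

/-- The order of locally finite measures is determined by the values on the semi-ring. -/
lemma measLE_of_le (hI : IsDissectingSemiring I) {μ ν : Measure S}
    (hμ : ∀ B ∈ I, μ B ≠ ∞) (hν : ∀ B ∈ I, ν B ≠ ∞) (h : ∀ B ∈ I, μ B ≤ ν B) :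
    MeasLE μ ν := by
  intro B hB hBb
  obtain ⟨F, hFI, hBF⟩ := hI.isBounded_covered B hBb
  set W : Set S := ⋃₀ ↑F with hW
  have hWI : W ∈ supClosure I :=
    supClosed_supClosure.sSup_mem F.finite_toSet (subset_supClosure hI.empty_mem)
      (hFI.trans subset_supClosure)
  have hWm : MeasurableSet W :=
    MeasurableSet.sUnion F.finite_toSet.countable fun t ht ↦ hI.measurableSet t (hFI ht)
  have hfin : ∀ m : Measure S, (∀ B ∈ I, m B ≠ ∞) → m W < ∞ := fun m hm ↦ by
    rw [hW, sUnion_eq_biUnion]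
    exact measure_biUnion_lt_top F.finite_toSet fun i hi ↦ (hm i (hFI hi)).lt_top
  set m := (μ + ν).restrict W with hm
  have : IsFiniteMeasure m := ⟨by
    simpa [hm] using ⟨hfin μ hμ, hfin ν hν⟩⟩
  refine ENNReal.le_of_forall_pos_le_add fun ε hε _ ↦ ?_
  obtain ⟨t, ht, hlt⟩ := exists_measure_symmDiff_lt_of_generateFrom_isSetSemiring (μ := m)
    hI.isSetSemiring ⟨I, hI.countable, subset_rfl, by simp [hI.sUnion_eq_univ]⟩
    hI.generateFrom_eq.symm hB (ε := (ε : ℝ≥0∞)) (by exact_mod_cast hε)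
  have htW : t ∩ W ∈ supClosure I := hI.isSetSemiring.isSetRing_supClosure.inter_mem ht hWI
  rw [hm, Measure.restrict_apply' hWm, Measure.add_apply] at hlt
  set d := t ∆ B ∩ W with hd
  have h1 : B ⊆ (t ∩ W) ∪ d := by
    intro z hz
    by_cases hzt : z ∈ t
    · exact Or.inl ⟨hzt, hBF hz⟩
    · exact Or.inr ⟨Or.inr ⟨hz, hzt⟩, hBF hz⟩
  have h2 : t ∩ W ⊆ B ∪ d := by
    intro z hz
    by_cases hzB : z ∈ B
    · exact Or.inl hzB
    · exact Or.inr ⟨Or.inl ⟨hz.1, hzB⟩, hz.2⟩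
  calc μ B ≤ μ (t ∩ W) + μ d := (measure_mono h1).trans (measure_union_le _ _)
    _ ≤ ν (t ∩ W) + μ d := add_le_add (hI.le_of_mem_supClosure h htW) le_rfl
    _ ≤ ν B + ν d + μ d := by
      gcongr; exact (measure_mono h2).trans (measure_union_le _ _)
    _ = ν B + (μ d + ν d) := by ring
    _ ≤ ν B + ε := by gcongr

end IsDissectingSemiring

/-- Association of nonnegative random variables follows from association of their
superlevel sets. -/
lemma lintegral_mul_lintegral_le_of_measure_superlevel {Ω : Type*} [MeasurableSpace Ω]
    {P : Measure Ω} [IsProbabilityMeasure P] {f g : Ω → ℝ} (hf : Measurable f) (hg : Measurable g)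
    (hf0 : 0 ≤ f) (hg0 : 0 ≤ g)
    (h : ∀ s t : ℝ, P {ω | s < f ω} * P {ω | t < g ω} ≤ P ({ω | s < f ω} ∩ {ω | t < g ω})) :
    (∫⁻ ω, ENNReal.ofReal (f ω) ∂P) * ∫⁻ ω, ENNReal.ofReal (g ω) ∂P ≤
      ∫⁻ ω, ENNReal.ofReal (f ω) * ENNReal.ofReal (g ω) ∂P := by
  have hfm : Measurable fun ω ↦ ENNReal.ofReal (f ω) := hf.ennreal_ofReal
  have hgm : Measurable fun ω ↦ ENNReal.ofReal (g ω) := hg.ennreal_ofReal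
  have hgl : ∀ t : ℝ, MeasurableSet {ω | t < g ω} := fun t ↦ measurableSet_lt measurable_const hg
  have hfl : ∀ t : ℝ, MeasurableSet {ω | t < f ω} := fun t ↦ measurableSet_lt measurable_const hf
  have hmono : ∀ (Q : Measure Ω) (u : Ω → ℝ), Measurable fun t : ℝ ↦ Q {ω | t < u ω} :=
    fun Q u ↦ Antitone.measurable fun _ _ hst ↦ measure_mono fun _ hω ↦ lt_of_le_of_lt hst hω
  have h1 : ∀ t : ℝ, (∫⁻ ω, ENNReal.ofReal (f ω) ∂P) * P {ω | t < g ω} ≤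
      P.withDensity (fun ω ↦ ENNReal.ofReal (f ω)) {ω | t < g ω} := fun t ↦ by
    rw [withDensity_apply _ (hgl t),
      lintegral_eq_lintegral_meas_lt _ (Eventually.of_forall hf0) hf.aemeasurable,
      lintegral_eq_lintegral_meas_lt _ (Eventually.of_forall hf0) hf.aemeasurable,
      ← lintegral_mul_const _ (hmono P f)]
    refine lintegral_mono fun s ↦ ?_
    rw [Measure.restrict_apply (hfl s)]
    exact h s t
  calc (∫⁻ ω, ENNReal.ofReal (f ω) ∂P) * ∫⁻ ω, ENNReal.ofReal (g ω) ∂P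
      = ∫⁻ t in Ioi (0 : ℝ), (∫⁻ ω, ENNReal.ofReal (f ω) ∂P) * P {ω | t < g ω} := by
        rw [lintegral_eq_lintegral_meas_lt P (Eventually.of_forall hg0) hg.aemeasurable,
          ← lintegral_const_mul _ (hmono P g)]
    _ ≤ ∫⁻ t in Ioi (0 : ℝ), P.withDensity (fun ω ↦ ENNReal.ofReal (f ω)) {ω | t < g ω} :=
        lintegral_mono h1
    _ = ∫⁻ ω, ENNReal.ofReal (g ω) ∂P.withDensity (fun ω ↦ ENNReal.ofReal (f ω)) :=
        (lintegral_eq_lintegral_meas_lt _ (Eventually.of_forall hg0) hg.aemeasurable).symm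
    _ = ∫⁻ ω, ENNReal.ofReal (f ω) * ENNReal.ofReal (g ω) ∂P :=
        lintegral_withDensity_eq_lintegral_mul _ hfm hgm

lemma integral_mul_integral_le_of_measure_superlevel {Ω : Type*} [MeasurableSpace Ω]
    {P : Measure Ω} [IsProbabilityMeasure P] {f g : Ω → ℝ} (hf : Measurable f) (hg : Measurable g)
    (hfb : ∃ C, ∀ ω, |f ω| ≤ C) (hgb : ∃ C, ∀ ω, |g ω| ≤ C)
    (h : ∀ s t : ℝ, P {ω | s < f ω} * P {ω | t < g ω} ≤ P ({ω | s < f ω} ∩ {ω | t < g ω})) :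
    (∫ ω, f ω ∂P) * ∫ ω, g ω ∂P ≤ ∫ ω, f ω * g ω ∂P := by
  obtain ⟨a, ha⟩ := hfb
  obtain ⟨b, hb⟩ := hgb
  have hfi : Integrable f P := .of_bound hf.aestronglyMeasurable a (Eventually.of_forall ha)
  have hgi : Integrable g P := .of_bound hg.aestronglyMeasurable b (Eventually.of_forall hb)
  have hfgi : Integrable (fun ω ↦ f ω * g ω) P :=
    hgi.bdd_mul hf.aestronglyMeasurable (Eventually.of_forall ha)
  have hfa : Integrable (fun ω ↦ f ω + a) P := hfi.add (integrable_const a)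
  have hgb : Integrable (fun ω ↦ g ω + b) P := hgi.add (integrable_const b)
  have hf0 : 0 ≤ fun ω ↦ f ω + a := fun ω ↦ by
    have := neg_le_of_abs_le (ha ω); simp only [Pi.zero_apply]; linarith
  have hg0 : 0 ≤ fun ω ↦ g ω + b := fun ω ↦ by
    have := neg_le_of_abs_le (hb ω); simp only [Pi.zero_apply]; linarith
  have hexp : (fun ω ↦ (f ω + a) * (g ω + b)) =
      fun ω ↦ f ω * g ω + b * f ω + (a * g ω + a * b) := by
    ext ω; ring
  have h1 : Integrable (fun ω ↦ f ω * g ω + b * f ω) P := hfgi.add (hfi.const_mul b)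
  have h2 : Integrable (fun ω ↦ a * g ω + a * b) P := (hgi.const_mul a).add (integrable_const _)
  have hfgi' : Integrable (fun ω ↦ (f ω + a) * (g ω + b)) P := hexp ▸ h1.add h2
  have key := lintegral_mul_lintegral_le_of_measure_superlevel (P := P) (hf.add_const a)
    (hg.add_const b) hf0 hg0 fun s t ↦ by
      have := h (s - a) (t - b)
      simpa only [sub_lt_iff_lt_add] using this
  simp_rw [← fun ω ↦ ENNReal.ofReal_mul (q := g ω + b) (hf0 ω)] at key
  rw [← ofReal_integral_eq_lintegral_ofReal hfa (Eventually.of_forall hf0),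
    ← ofReal_integral_eq_lintegral_ofReal hgb (Eventually.of_forall hg0),
    ← ofReal_integral_eq_lintegral_ofReal hfgi'
      (Eventually.of_forall fun ω ↦ mul_nonneg (hf0 ω) (hg0 ω)),
    ← ENNReal.ofReal_mul (integral_nonneg hf0),
    ENNReal.ofReal_le_ofReal_iff (integral_nonneg fun ω ↦ mul_nonneg (hf0 ω) (hg0 ω))] at key
  have e : ∫ ω, (f ω + a) * (g ω + b) ∂P =
      (∫ ω, f ω * g ω ∂P) + b * (∫ ω, f ω ∂P) + (a * (∫ ω, g ω ∂P) + a * b) := by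
    rw [hexp, integral_add h1 h2, integral_add hfgi (hfi.const_mul b),
      integral_add (hgi.const_mul a) (integrable_const _), integral_const_mul, integral_const_mul]
    simp
  rw [e, integral_add hfi (integrable_const a), integral_add hgi (integrable_const b)] at key
  simp only [integral_const, probReal_univ, smul_eq_mul, one_mul] at key
  nlinarith

section RandomMeasure

variable {Ω S : Type*} [MeasurableSpace Ω] [MeasurableSpace S]

lemma measurable_eval_sets {M : Ω → Measure S} (hM : Measurable M) {I : Set (Set S)}
    (hI : ∀ B ∈ I, MeasurableSet B) : Measurable fun ω (B : I) ↦ M ω B :=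
  measurable_pi_lambda _ fun B ↦ (Measure.measurable_coe (hI B B.2)).comp hM

variable [MetricSpace S] {P : Measure Ω} [IsProbabilityMeasure P] {M : Ω → Measure S}
  {I : Set (Set S)}

/-- Association of the values on finitely many, not necessarily disjoint, members of the
semi-ring. -/
lemma measure_mul_le_of_finset (hM : Measurable M) (hI : IsDissectingSemiring I)
    (h : ∀ (n : ℕ), 0 < n → ∀ B : Fin n → Set S, (∀ i, B i ∈ I) →
      Pairwise (Function.onFun Disjoint B) → PosAssoc P (fun i ω ↦ M ω (B i)))
    (s : Finset I) {U V : Set (I → ℝ≥0∞)} (hU : MeasurableSet U) (hV : MeasurableSet V)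
    (hUs : ∀ x y : I → ℝ≥0∞, (∀ i ∈ s, x i ≤ y i) → x ∈ U → y ∈ U)
    (hVs : ∀ x y : I → ℝ≥0∞, (∀ i ∈ s, x i ≤ y i) → x ∈ V → y ∈ V) :
    P ((fun ω (B : I) ↦ M ω B) ⁻¹' U) * P ((fun ω (B : I) ↦ M ω B) ⁻¹' V) ≤
      P ((fun ω (B : I) ↦ M ω B) ⁻¹' U ∩ (fun ω (B : I) ↦ M ω B) ⁻¹' V) := by
  classical
  obtain ⟨R, hRI, hR0, hRd, hR⟩ := hI.isSetSemiring.exists_disjoint_refinement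
    (s.image Subtype.val) (by
      intro A hA
      obtain ⟨A, -, rfl⟩ := Finset.mem_image.1 hA
      exact A.2)
  let e := R.equivFin
  let B : Fin R.card → Set S := fun i ↦ e.symm i
  have hBI : ∀ i, B i ∈ I := fun i ↦ hRI (e.symm i).2
  have hBd : Pairwise (Function.onFun Disjoint B) := fun i j hij ↦ by
    refine disjoint_left.2 fun z hzi hzj ↦ hij ?_
    exact e.symm.injective (Subtype.ext (hRd _ (e.symm i).2 _ (e.symm j).2 z hzi hzj))
  let x : (↥(univ : Set (Fin R.card)) → ℝ≥0∞) → I → ℝ≥0∞ :=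
    fun y A ↦ ∑ i : ↥(univ : Set (Fin R.card)), if B i ⊆ A then y i else 0
  have hxm : Measurable x := measurable_pi_lambda _ fun A ↦
    Finset.measurable_sum _ fun i _ ↦ by split_ifs <;> fun_prop
  have hxmono : Monotone x := fun y z hyz A ↦
    Finset.sum_le_sum fun i _ ↦ by split_ifs; exacts [hyz i, le_rfl]
  have hx : ∀ ω, ∀ A ∈ s, x (fun i ↦ M ω (B i)) A = M ω A := fun ω A hA ↦ by
    have hA' : (A : Set S) = ⋃ i ∈ Finset.univ.filter (fun i ↦ B i ⊆ A), B i := by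
      ext z
      simp only [Finset.mem_filter, Finset.mem_univ, true_and, mem_iUnion, exists_prop]
      refine ⟨fun hz ↦ ?_, fun ⟨i, hi, hz⟩ ↦ hi hz⟩
      obtain ⟨r, hr, hzr, hrA⟩ := hR A (Finset.mem_image_of_mem _ hA) z hz
      exact ⟨e ⟨r, hr⟩, by simpa [B] using hrA, by simpa [B] using hzr⟩
    conv_rhs => rw [hA', measure_biUnion_finset (fun i _ j _ hij ↦ hBd hij)
      fun i _ ↦ hI.measurableSet _ (hBI i), Finset.sum_filter]
    exact Fintype.sum_equiv (Equiv.Set.univ _) _ _ fun i ↦ rfl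
  have mem_iff : ∀ W : Set (I → ℝ≥0∞),
      (∀ x y : I → ℝ≥0∞, (∀ i ∈ s, x i ≤ y i) → x ∈ W → y ∈ W) →
      ∀ ω, x (fun i ↦ M ω (B i)) ∈ W ↔ (fun A : I ↦ M ω A) ∈ W := fun W hW ω ↦
    ⟨hW _ _ fun A hA ↦ (hx ω A hA).le, hW _ _ fun A hA ↦ (hx ω A hA).ge⟩
  have ind : ∀ W : Set (I → ℝ≥0∞), MeasurableSet W →
      (∀ x y : I → ℝ≥0∞, (∀ i ∈ s, x i ≤ y i) → x ∈ W → y ∈ W) →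
      Measurable ((x ⁻¹' W).indicator (1 : (↥(univ : Set (Fin R.card)) → ℝ≥0∞) → ℝ)) ∧
      Monotone ((x ⁻¹' W).indicator (1 : (↥(univ : Set (Fin R.card)) → ℝ≥0∞) → ℝ)) ∧
      (∃ C, ∀ y, |(x ⁻¹' W).indicator (1 : (↥(univ : Set (Fin R.card)) → ℝ≥0∞) → ℝ) y| ≤ C) ∧
      ∀ ω, (x ⁻¹' W).indicator (1 : (↥(univ : Set (Fin R.card)) → ℝ≥0∞) → ℝ)
          (fun i ↦ M ω (B i)) =
        ((fun ω (B : I) ↦ M ω B) ⁻¹' W).indicator 1 ω := fun W hWm hW ↦ by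
    refine ⟨measurable_one.indicator (hxm hWm), fun y z hyz ↦ ?_, ⟨1, fun y ↦ ?_⟩, fun ω ↦ ?_⟩
    · by_cases hy : x y ∈ W
      · have hz : x z ∈ W := hW _ _ (fun i _ ↦ hxmono hyz i) hy
        simp [indicator, hy, hz]
      · rw [indicator_of_notMem (by exact hy)]
        exact indicator_nonneg (fun _ _ ↦ zero_le_one) _
    · by_cases hy : x y ∈ W <;> simp [indicator, hy]
    · simp only [indicator, mem_preimage, mem_iff W hW ω, Pi.one_apply]
  obtain ⟨hU1, hU2, hU3, hU4⟩ := ind U hU hUs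
  obtain ⟨hV1, hV2, hV3, hV4⟩ := ind V hV hVs
  have key := h R.card (Finset.card_pos.2 ⟨∅, hR0⟩) B hBI hBd univ _ _ hU1 hU2 hU3 hV1 hV2 hV3
  have hXm := measurable_eval_sets hM hI.measurableSet
  simp only [hU4, hV4] at key
  have hmul : ∀ ω, ((fun ω (B : I) ↦ M ω B) ⁻¹' U).indicator (1 : Ω → ℝ) ω *
      ((fun ω (B : I) ↦ M ω B) ⁻¹' V).indicator (1 : Ω → ℝ) ω =
      ((fun ω (B : I) ↦ M ω B) ⁻¹' U ∩ (fun ω (B : I) ↦ M ω B) ⁻¹' V).indicator 1 ω := fun ω ↦ by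
    rw [inter_indicator_one]; rfl
  simp only [hmul] at key
  rw [integral_indicator_one (hXm hU), integral_indicator_one (hXm hV),
    integral_indicator_one ((hXm hU).inter (hXm hV))] at key
  rw [← ENNReal.toReal_le_toReal (by finiteness) (by finiteness), ENNReal.toReal_mul]
  exact key

lemma upperClosure_eq_iInter_of_isCompact {ι : Type*} {K : Set (ι → ℝ≥0∞)} (hK : IsCompact K) :
    (upperClosure K : Set (ι → ℝ≥0∞)) =
      ⋂ s : Finset ι, {x | ∃ k ∈ K, ∀ i ∈ s, k i ≤ x i} := by
  classical
  ext x
  simp only [SetLike.mem_coe, mem_upperClosure, mem_iInter, mem_ofPred_eq]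
  refine ⟨fun ⟨k, hk, hkx⟩ s ↦ ⟨k, hk, fun i _ ↦ hkx i⟩, fun h ↦ ?_⟩
  have hcl : ∀ s : Finset ι, IsClosed {k : ι → ℝ≥0∞ | ∀ i ∈ s, k i ≤ x i} := fun s ↦ by
    simp only [ofPred_forall]
    exact isClosed_biInter fun i _ ↦ isClosed_le (continuous_apply i) continuous_const
  obtain ⟨k, hk⟩ := IsCompact.nonempty_iInter_of_directed_nonempty_isCompact_isClosed
    (fun s : Finset ι ↦ K ∩ {k | ∀ i ∈ s, k i ≤ x i})
    (fun s t ↦ ⟨s ∪ t, fun k hk ↦ ⟨hk.1, fun i hi ↦ hk.2 i (Finset.mem_union_left t hi)⟩,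
      fun k hk ↦ ⟨hk.1, fun i hi ↦ hk.2 i (Finset.mem_union_right s hi)⟩⟩)
    h (fun s ↦ hK.inter_right (hcl s)) (fun s ↦ hK.isClosed.inter (hcl s))
  rw [mem_iInter] at hk
  exact ⟨k, (hk ∅).1, fun i ↦ (hk {i}).2 i (Finset.mem_singleton_self i)⟩

lemma isClosed_setOf_exists_forall_finset_le {ι : Type*} {K : Set (ι → ℝ≥0∞)} (hK : IsCompact K)
    (s : Finset ι) : IsClosed {x : ι → ℝ≥0∞ | ∃ k ∈ K, ∀ i ∈ s, k i ≤ x i} := by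
  have h : IsClosed {p : (ι → ℝ≥0∞) × (ι → ℝ≥0∞) | p.1 ∈ K ∧ ∀ i ∈ s, p.1 i ≤ p.2 i} := by
    simp only [ofPred_and, ofPred_forall]
    exact (hK.isClosed.preimage continuous_fst).inter <| isClosed_biInter fun i _ ↦
      isClosed_le ((continuous_apply i).comp continuous_fst)
        ((continuous_apply i).comp continuous_snd)
  convert isClosedMap_snd_of_compactSpace _ h using 1
  ext x
  simp

/-- Association of the values on all members of the semi-ring, for compactly generated
upper sets. -/
lemma measure_mul_le_of_isCompact (hM : Measurable M) (hI : IsDissectingSemiring I)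
    (h : ∀ (n : ℕ), 0 < n → ∀ B : Fin n → Set S, (∀ i, B i ∈ I) →
      Pairwise (Function.onFun Disjoint B) → PosAssoc P (fun i ω ↦ M ω (B i)))
    {K L : Set (I → ℝ≥0∞)} (hK : IsCompact K) (hL : IsCompact L) :
    P ((fun ω (B : I) ↦ M ω B) ⁻¹' upperClosure K) *
        P ((fun ω (B : I) ↦ M ω B) ⁻¹' upperClosure L) ≤
      P ((fun ω (B : I) ↦ M ω B) ⁻¹' upperClosure K ∩
        (fun ω (B : I) ↦ M ω B) ⁻¹' upperClosure L) := by
  have : Countable I := hI.countable.to_subtype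
  have hXm := measurable_eval_sets hM hI.measurableSet
  have hcl : ∀ {K : Set (I → ℝ≥0∞)}, IsCompact K → ∀ s : Finset I,
      MeasurableSet {x : I → ℝ≥0∞ | ∃ k ∈ K, ∀ i ∈ s, k i ≤ x i} := fun hK s ↦
    (isClosed_setOf_exists_forall_finset_le hK s).measurableSet
  have hanti : ∀ K : Set (I → ℝ≥0∞), Antitone fun s : Finset I ↦
      (fun ω (B : I) ↦ M ω B) ⁻¹' {x | ∃ k ∈ K, ∀ i ∈ s, k i ≤ x i} :=
    fun K s t hst ω ⟨k, hk, hkx⟩ ↦ ⟨k, hk, fun i hi ↦ hkx i (hst hi)⟩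
  have hlim : ∀ {K : Set (I → ℝ≥0∞)}, IsCompact K → Tendsto (fun s : Finset I ↦
      P ((fun ω (B : I) ↦ M ω B) ⁻¹' {x | ∃ k ∈ K, ∀ i ∈ s, k i ≤ x i})) atTop
      (𝓝 (P ((fun ω (B : I) ↦ M ω B) ⁻¹' upperClosure K))) := fun {K} hK ↦ by
    rw [upperClosure_eq_iInter_of_isCompact hK, preimage_iInter]
    exact tendsto_measure_iInter_atTop (fun s ↦ (hXm (hcl hK s)).nullMeasurableSet) (hanti K)
      ⟨∅, measure_ne_top _ _⟩
  have hlim2 : Tendsto (fun s : Finset I ↦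
      P ((fun ω (B : I) ↦ M ω B) ⁻¹' {x | ∃ k ∈ K, ∀ i ∈ s, k i ≤ x i} ∩
        (fun ω (B : I) ↦ M ω B) ⁻¹' {x | ∃ k ∈ L, ∀ i ∈ s, k i ≤ x i})) atTop
      (𝓝 (P ((fun ω (B : I) ↦ M ω B) ⁻¹' upperClosure K ∩
        (fun ω (B : I) ↦ M ω B) ⁻¹' upperClosure L))) := by
    rw [upperClosure_eq_iInter_of_isCompact hK, upperClosure_eq_iInter_of_isCompact hL,
      preimage_iInter, preimage_iInter, ← iInter_inter_distrib]
    exact tendsto_measure_iInter_atTop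
      (fun s ↦ ((hXm (hcl hK s)).inter (hXm (hcl hL s))).nullMeasurableSet)
      (fun s t hst ↦ inter_subset_inter (hanti K hst) (hanti L hst)) ⟨∅, measure_ne_top _ _⟩
  refine le_of_tendsto_of_tendsto' (ENNReal.Tendsto.mul (hlim hK) (Or.inr (measure_ne_top _ _))
    (hlim hL) (Or.inr (measure_ne_top _ _))) hlim2 fun s ↦ ?_
  exact measure_mul_le_of_finset hM hI h s (hcl hK s) (hcl hL s)
    (fun x y hxy ⟨k, hk, hkx⟩ ↦ ⟨k, hk, fun i hi ↦ (hkx i hi).trans (hxy i hi)⟩)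
    (fun x y hxy ⟨k, hk, hkx⟩ ↦ ⟨k, hk, fun i hi ↦ (hkx i hi).trans (hxy i hi)⟩)

variable [StandardBorelSpace S]

/-- The restriction of a random measure to a member `A` of the semi-ring is almost surely a
measurable function of the values on the semi-ring. -/
lemma exists_measurable_restrict_ae_eq (hM : Measurable M) (hI : IsDissectingSemiring I)
    (hfin : ∀ ω, ∀ B ∈ I, M ω B ≠ ∞) {A : Set S} (hA : A ∈ I) :
    ∃ N : (I → ℝ≥0∞) → Measure S, Measurable N ∧
      ∀ᵐ ω ∂P, N (fun B : I ↦ M ω B) = (M ω).restrict A := by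
  rcases isEmpty_or_nonempty S with hS | hS
  · exact ⟨0, measurable_const, Eventually.of_forall fun ω ↦ Subsingleton.elim _ _⟩
  have hAm := hI.measurableSet A hA
  set X : Ω → I → ℝ≥0∞ := fun ω B ↦ M ω B with hX
  have hXm : Measurable X := measurable_eval_sets hM hI.measurableSet
  let κ : Kernel Ω S :=
    { toFun := fun ω ↦ (M ω A)⁻¹ • (M ω).restrict A
      measurable' := Measure.measurable_of_measurable_coe _ fun t ht ↦ by
        simp only [Measure.smul_apply, smul_eq_mul, Measure.restrict_apply ht]
        exact ((Measure.measurable_coe hAm).comp hM).inv.mul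
          ((Measure.measurable_coe (ht.inter hAm)).comp hM) }
  have hκ : ∀ ω {t}, MeasurableSet t → κ ω t = (M ω A)⁻¹ * M ω (t ∩ A) := fun ω t ht ↦ by
    rw [← Measure.restrict_apply ht]; rfl
  have : IsFiniteKernel κ := ⟨1, ENNReal.one_lt_top, fun ω ↦ by
    rw [hκ ω .univ, univ_inter]; exact ENNReal.inv_mul_le_one _⟩
  set ρ : Measure ((I → ℝ≥0∞) × S) := (P ⊗ₘ κ).map (Prod.map X id) with hρ
  have hρprod : ∀ {C : Set (I → ℝ≥0∞)} {t : Set S}, MeasurableSet C → MeasurableSet t →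
      ρ (C ×ˢ t) = ∫⁻ ω in X ⁻¹' C, (M ω A)⁻¹ * M ω (t ∩ A) ∂P := fun {C t} hC ht ↦ by
    rw [hρ, Measure.map_apply (hXm.prodMap measurable_id) (hC.prod ht), preimage_prod_map_prod,
      preimage_id, Measure.compProd_apply_prod (hXm hC) ht]
    simp only [hκ _ ht]
  let a : I := ⟨A, hA⟩
  have hw : Measurable fun x : I → ℝ≥0∞ ↦ (x a)⁻¹ * x a := by fun_prop
  have hfst : ρ.fst = (P.map X).withDensity fun x ↦ (x a)⁻¹ * x a := by
    ext C hC
    rw [Measure.fst_apply hC, ← prod_univ, hρprod hC .univ, withDensity_apply _ hC,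
      setLIntegral_map hC hw hXm]
    simp [hX, a]
  have key : ∀ B ∈ I, ∀ᵐ ω ∂P, M ω A * ρ.condKernel (X ω) B = M ω (B ∩ A) := fun B hB ↦ by
    have hBm := hI.measurableSet B hB
    let b : I := ⟨B ∩ A, hI.inter_mem _ hB _ hA⟩
    have hBk : Measurable fun x ↦ ρ.condKernel x B := Kernel.measurable_coe _ hBm
    have hb : Measurable fun x : I → ℝ≥0∞ ↦ (x a)⁻¹ * x b := by fun_prop
    have hae : (fun x ↦ (x a)⁻¹ * x a * ρ.condKernel x B) =ᵐ[P.map X]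
        fun x ↦ (x a)⁻¹ * x b := by
      have : IsProbabilityMeasure (P.map X) := Measure.isProbabilityMeasure_map hXm.aemeasurable
      refine ae_eq_of_forall_setLIntegral_eq_of_sigmaFinite (hw.mul hBk) hb fun C hC _ ↦ ?_
      rw [setLIntegral_map hC hb hXm]
      have h1 := hρprod hC hBm
      conv_lhs at h1 => rw [← ρ.disintegrate ρ.condKernel,
        Measure.compProd_apply_prod hC hBm, hfst,
        setLIntegral_withDensity_eq_setLIntegral_mul _ hw hBk hC]
      exact h1
    filter_upwards [ae_of_ae_map hXm.aemeasurable hae] with ω hω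
    rcases eq_or_ne (M ω A) 0 with h0 | h0
    · rw [h0, zero_mul, measure_mono_null inter_subset_right h0]
    · have hω' : (M ω A)⁻¹ * M ω A * ρ.condKernel (X ω) B = (M ω A)⁻¹ * M ω (B ∩ A) := hω
      rw [ENNReal.inv_mul_cancel h0 (hfin ω A hA), one_mul] at hω'
      rw [hω', ← mul_assoc, ENNReal.mul_inv_cancel h0 (hfin ω A hA), one_mul]
  refine ⟨fun x ↦ x a • ρ.condKernel x, Measure.measurable_of_measurable_coe _ fun t ht ↦ ?_, ?_⟩
  · simp only [Measure.smul_apply, smul_eq_mul]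
    exact (measurable_pi_apply a).mul (Kernel.measurable_coe _ ht)
  · filter_upwards [(ae_ball_iff hI.countable).2 key] with ω hω
    have hω' : ∀ B ∈ I, (X ω a • ρ.condKernel (X ω)) B = (M ω).restrict A B := fun B hB ↦ by
      rw [Measure.restrict_apply (hI.measurableSet B hB), ← hω B hB]; rfl
    refine hI.measure_ext (fun B hB ↦ ?_) hω'
    rw [hω' B hB]
    exact ((Measure.restrict_apply_le _ _).trans_lt (hfin ω B hB).lt_top).ne

/-- A locally finite random measure is almost surely a measurable function of its values on the
semi-ring. -/
lemma exists_measurable_ae_eq (hM : Measurable M) (hI : IsDissectingSemiring I)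
    (hfin : ∀ ω, ∀ B ∈ I, M ω B ≠ ∞) :
    ∃ ψ : (I → ℝ≥0∞) → Measure S, Measurable ψ ∧ ∀ᵐ ω ∂P, ψ (fun B : I ↦ M ω B) = M ω := by
  obtain ⟨A, rfl⟩ := hI.countable.exists_eq_range ⟨∅, hI.empty_mem⟩
  have hAm : ∀ k, MeasurableSet (A k) := fun k ↦ hI.measurableSet _ (mem_range_self k)
  have hdm : ∀ k, MeasurableSet (disjointed A k) := MeasurableSet.disjointed hAm
  choose N hNm hN using fun k ↦
    exists_measurable_restrict_ae_eq (P := P) hM hI hfin (mem_range_self (f := A) k)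
  refine ⟨fun x ↦ Measure.sum fun k ↦ (N k x).restrict (disjointed A k),
    Measure.measurable_of_measurable_coe _ fun t ht ↦ ?_, ?_⟩
  · simp only [Measure.sum_apply _ ht, Measure.restrict_apply ht]
    exact Measurable.tsum fun k ↦
      (Measure.measurable_coe (ht.inter (hdm k))).comp (hNm k)
  · filter_upwards [ae_all_iff.2 hN] with ω hω
    simp only [hω, Measure.restrict_restrict (hdm _),
      inter_eq_left.2 (disjointed_subset A _)]
    rw [← Measure.restrict_iUnion (disjoint_disjointed A) hdm, iUnion_disjointed, ← sUnion_range,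
      hI.sUnion_eq_univ, Measure.restrict_univ]

/-- Inner approximation of events `M ∈ U`, where `U` is increasing, by events generated by
compact sets of values on the semi-ring. -/
lemma exists_isCompact_lt_measure (hM : Measurable M) (hI : IsDissectingSemiring I)
    (hfin : ∀ ω, ∀ B ∈ I, M ω B ≠ ∞) {U : Set (Measure S)} (hU : MeasurableSet U)
    (hUmono : ∀ μ ν, MeasLE μ ν → μ ∈ U → ν ∈ U) {r : ℝ≥0∞} (hr : r < P (M ⁻¹' U)) :
    ∃ K : Set (I → ℝ≥0∞), IsCompact K ∧ r < P ((fun ω (B : I) ↦ M ω B) ⁻¹' upperClosure K) ∧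
      (fun ω (B : I) ↦ M ω B) ⁻¹' upperClosure K ⊆ M ⁻¹' U := by
  have : Countable I := hI.countable.to_subtype
  obtain ⟨ψ, hψm, hψ⟩ := exists_measurable_ae_eq (P := P) hM hI hfin
  have hXm := measurable_eval_sets hM hI.measurableSet
  have hψX := measurable_eval_sets hψm hI.measurableSet
  have : IsProbabilityMeasure (P.map fun ω (B : I) ↦ M ω B) :=
    Measure.isProbabilityMeasure_map hXm.aemeasurable
  let D : Set (I → ℝ≥0∞) :=
    {x | (fun B : I ↦ ψ x B) = x} ∩ ψ ⁻¹' U ∩ {x | ∀ B : I, x B ≠ ∞}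
  have hDm : MeasurableSet D := by
    refine ((measurableSet_eq_fun hψX measurable_id).inter (hψm hU)).inter ?_
    rw [ofPred_forall]
    exact .iInter fun B ↦ (measurableSet_eq_fun (measurable_pi_apply B) measurable_const).compl
  have hD : P (M ⁻¹' U) ≤ P.map (fun ω (B : I) ↦ M ω B) D := by
    rw [Measure.map_apply hXm hDm]
    refine measure_mono_ae ?_
    filter_upwards [hψ] with ω hω hωU
    refine ⟨⟨?_, ?_⟩, fun B ↦ hfin ω B B.2⟩
    · change (fun B : I ↦ ψ _ B) = _
      rw [hω]
    · change ψ _ ∈ U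
      rwa [hω]
  obtain ⟨K, hKD, hK, hrK⟩ :=
    hDm.exists_lt_isClosed_of_ne_top (measure_ne_top _ _) (hr.trans_le hD)
  refine ⟨K, hK.isCompact, ?_, ?_⟩
  · rw [Measure.map_apply hXm hK.measurableSet] at hrK
    exact hrK.trans_le (measure_mono (preimage_mono subset_upperClosure))
  · rintro ω ⟨k, hk, hkω⟩
    obtain ⟨⟨hkψ, hkU⟩, hkfin⟩ := hKD hk
    have hkψ' : ∀ B (hB : B ∈ I), ψ k B = k ⟨B, hB⟩ := fun B hB ↦ congrFun hkψ ⟨B, hB⟩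
    refine hUmono _ _ (hI.measLE_of_le (fun B hB ↦ ?_) (hfin ω) fun B hB ↦ ?_) hkU
    · rw [hkψ' B hB]; exact hkfin _
    · rw [hkψ' B hB]; exact hkω _

lemma measure_mul_le_of_increasing (hM : Measurable M) (hI : IsDissectingSemiring I)
    (hfin : ∀ ω, ∀ B ∈ I, M ω B ≠ ∞)
    (h : ∀ (n : ℕ), 0 < n → ∀ B : Fin n → Set S, (∀ i, B i ∈ I) →
      Pairwise (Function.onFun Disjoint B) → PosAssoc P (fun i ω ↦ M ω (B i)))
    {U V : Set (Measure S)} (hU : MeasurableSet U) (hV : MeasurableSet V)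
    (hUmono : ∀ μ ν, MeasLE μ ν → μ ∈ U → ν ∈ U) (hVmono : ∀ μ ν, MeasLE μ ν → μ ∈ V → ν ∈ V) :
    P (M ⁻¹' U) * P (M ⁻¹' V) ≤ P (M ⁻¹' U ∩ M ⁻¹' V) := by
  refine ENNReal.mul_le_of_forall_lt fun a ha b hb ↦ ?_
  obtain ⟨K, hK, haK, hKU⟩ := exists_isCompact_lt_measure hM hI hfin hU hUmono ha
  obtain ⟨L, hL, hbL, hLV⟩ := exists_isCompact_lt_measure hM hI hfin hV hVmono hb
  exact ((mul_le_mul' haK.le hbL.le).trans (measure_mul_le_of_isCompact hM hI h hK hL)).trans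
    (measure_mono (inter_subset_inter hKU hLV))

end RandomMeasure

/-- A random measure `M` on a Polish space `S` is positively associated if and only if,
for every `n ≥ 1` and all pairwise disjoint sets `B 1, …, B n` from a countable
topological dissecting semi-ring `I` of bounded Borel sets generating the Borel σ-field,
the random vector `(M (B 1), …, M (B n))` is positively associated. -/
theorem rmPosAssoc_iff_finite_dimensional
    {Ω S : Type*} [MeasurableSpace Ω]
    [MetricSpace S] [CompleteSpace S] [SecondCountableTopology S]
    [MeasurableSpace S] [BorelSpace S]
    (P : Measure Ω) [IsProbabilityMeasure P]
    (M : Ω → Measure S) (hMmeas : Measurable M)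
    (hRadon : ∀ ω, ∀ B : Set S, Bornology.IsBounded B → M ω B < ⊤)
    (I : Set (Set S)) (hI : IsDissectingSemiring I) :
    RMPosAssoc P M ↔
      ∀ (n : ℕ), 0 < n → ∀ B : Fin n → Set S, (∀ i, B i ∈ I) →
        Pairwise (Function.onFun Disjoint B) →
        PosAssoc P (fun i ω => M ω (B i)) := by
  refine ⟨fun h n _ B hB _ J f g hf hfm hfb hg hgm hgb ↦ ?_, fun h F G hF hFm hFb hG hGm hGb ↦ ?_⟩
  · have hev : Measurable fun (μ : Measure S) (j : J) ↦ μ (B j) :=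
      measurable_pi_lambda _ fun j ↦ Measure.measurable_coe (hI.measurableSet _ (hB j))
    have hmono : ∀ u : (J → ℝ≥0∞) → ℝ, Monotone u →
        MeasMono fun μ : Measure S ↦ u fun j ↦ μ (B j) := fun u hu μ ν hμν ↦
      hu fun j ↦ hμν _ (hI.measurableSet _ (hB j)) (hI.isBounded _ (hB j))
    exact h (fun μ ↦ f fun j ↦ μ (B j)) (fun μ ↦ g fun j ↦ μ (B j))
      (hf.comp hev) (hmono f hfm) (hfb.imp fun C hC μ ↦ hC _)
      (hg.comp hev) (hmono g hgm) (hgb.imp fun C hC μ ↦ hC _)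
  · refine integral_mul_integral_le_of_measure_superlevel (hF.comp hMmeas) (hG.comp hMmeas)
      (hFb.imp fun C hC ω ↦ hC _) (hGb.imp fun C hC ω ↦ hC _) fun s t ↦ ?_
    exact measure_mul_le_of_increasing hMmeas hI
      (fun ω B hB ↦ (hRadon ω B (hI.isBounded B hB)).ne) h
      (measurableSet_lt measurable_const hF) (measurableSet_lt measurable_const hG)
      (fun μ ν hμν hμ ↦ lt_of_lt_of_le hμ (hFm μ ν hμν))
      (fun μ ν hμν hμ ↦ lt_of_lt_of_le hμ (hGm μ ν hμν))
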